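/- For every normal fuzzy logic program P and every interpretation I, lfp(J ↦ first component of A_P(J,I)) = lfp(T_{P_I}); both least fixpoints exist since both operators are ≤-monotone. -/

import Mathlib

open scoped Classical

/-- Normal fuzzy formulas over truth values `V` and atoms `A`: constants, atoms,
negated atoms, and applications of `n`-ary connectives given by their truth functions. -/
inductive FForm (V : Type*) (A : Type*) : Type _ where
  | const : V → FForm V A
  | atom : A → FForm V A
  | natom : A → FForm V A
  | app : (n : ℕ) → ((Fin n → V) → V) → (Fin n → FForm V A) → FForm V A

namespace FForm

variable {V : Type*} {A : Type*} [CompleteLattice V]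

/-- All connective truth functions occurring in the formula are monotone. -/
def Good : FForm V A → Prop
  | const _ => True
  | atom _ => True
  | natom _ => True
  | app _ f args => Monotone f ∧ ∀ i, Good (args i)

/-- Evaluation `⟦φ⟧_{(L,U)}` of a formula under a pair of interpretations:
atoms are evaluated by `L`, negated atoms by `∼ U(·)`. -/
def evalPair (ng : V → V) (L U : A → V) : FForm V A → V
  | const c => c
  | atom p => L p
  | natom p => ng (U p)
  | app _ f args => f (fun i => evalPair ng L U (args i))

/-- Evaluation `⟦φ⟧_I` under a single interpretation. -/
def evalI (ng : V → V) (I : A → V) (φ : FForm V A) : V := evalPair ng I I φ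

end FForm

/-- A rule `p ←ᵢ^θ B` of a normal fuzzy logic program, carrying its
conjunctor truth function. -/
structure Rule (V : Type*) (A : Type*) where
  head : A
  weight : V
  conj : V → V → V
  body : FForm V A

variable {V : Type*} {A : Type*} [CompleteLattice V]

/-- All rule bodies are built from monotone connectives and all conjunctors are
monotone in both arguments. -/
def GoodProgram (P : Set (Rule V A)) : Prop :=
  ∀ r ∈ P, FForm.Good r.body ∧ (∀ x : V, Monotone (r.conj x)) ∧
    (∀ y : V, Monotone (fun x => r.conj x y))

/-- The immediate consequence operator `T_P`. -/
noncomputable def Tp (ng : V → V) (P : Set (Rule V A)) (I : A → V) : A → V :=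
  fun p => sSup {v | ∃ r ∈ P, r.head = p ∧ v = r.conj r.weight (FForm.evalI ng I r.body)}

/-- The approximator `A_P` on pairs of interpretations. -/
noncomputable def Ap (ng : V → V) (P : Set (Rule V A)) :
    (A → V) × (A → V) → (A → V) × (A → V) :=
  fun LU =>
    (fun p => sSup {v | ∃ r ∈ P, r.head = p ∧
        v = r.conj r.weight (FForm.evalPair ng LU.1 LU.2 r.body)},
     fun p => sSup {v | ∃ r ∈ P, r.head = p ∧
        v = r.conj r.weight (FForm.evalPair ng LU.2 LU.1 r.body)})

/-- The precision order `≤ₚ` on pairs of interpretations. -/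
def prec (x y : (A → V) × (A → V)) : Prop := x.1 ≤ y.1 ∧ y.2 ≤ x.2

/-- The least fixpoint of a (monotone) operator on a complete lattice,
via Knaster–Tarski. -/
noncomputable def lfp {α : Type*} [CompleteLattice α] (F : α → α) : α :=
  sInf {x | F x ≤ x}

/-- The stable approximator `B*` associated to an operator `B` on pairs. -/
noncomputable def stableAp (F : (A → V) × (A → V) → (A → V) × (A → V)) :
    (A → V) × (A → V) → (A → V) × (A → V) :=
  fun LU => (lfp (fun L' => (F (L', LU.2)).1), lfp (fun U' => (F (LU.1, U')).2))


namespace FForm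

variable {V : Type*} {A : Type*} [CompleteLattice V]

/-- The positive formula `B_I`: every negated atom `∼q` is replaced by the
constant `∼I(q)`. -/
def reduct (ng : V → V) (I : A → V) : FForm V A → FForm V A
  | const c => const c
  | atom p => atom p
  | natom p => const (ng (I p))
  | app n f args => app n f (fun i => reduct ng I (args i))

end FForm

/-- The reduct `P_I` of a program: each rule body `B` is replaced by `B_I`. -/
def reductP {V : Type*} {A : Type*} [CompleteLattice V]
    (ng : V → V) (P : Set (Rule V A)) (I : A → V) : Set (Rule V A) :=
  (fun r => Rule.mk r.head r.weight r.conj (FForm.reduct ng I r.body)) '' P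

/-- Evaluating `B_J` under `I` is evaluating `B` under the pair `(I, J)`. -/
theorem FForm.evalI_reduct {V : Type*} {A : Type*} [CompleteLattice V]
    (ng : V → V) (J I : A → V) (φ : FForm V A) :
    FForm.evalI ng J (FForm.reduct ng I φ) = FForm.evalPair ng J I φ := by
  induction φ with
  | const c => rfl
  | atom p => rfl
  | natom p => rfl
  | app n f args ih =>
    exact congrArg f (funext ih)

/-- Pair evaluation is monotone in its first interpretation. -/
theorem FForm.evalPair_mono {V : Type*} {A : Type*} [CompleteLattice V]
    (ng : V → V) (I : A → V) (φ : FForm V A) (hφ : FForm.Good φ) :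
    Monotone (fun J => FForm.evalPair ng J I φ) := by
  intro J K hJK
  induction φ with
  | const c => exact le_rfl
  | atom p => exact hJK p
  | natom p => exact le_rfl
  | app n f args ih => exact hφ.1 (fun i => ih i (hφ.2 i))

/-- The operators `J ↦ (A_P(J,I))₁` and `T_{P_I}` coincide. -/
theorem Ap_fst_eq_Tp_reductP {V : Type*} {A : Type*} [CompleteLattice V]
    (ng : V → V) (P : Set (Rule V A)) (I : A → V) :
    (fun J => (Ap ng P (J, I)).1) = Tp ng (reductP ng P I) := by
  funext J p
  simp [Ap, Tp, reductP, FForm.evalI_reduct]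

/-- The operator `J ↦ (A_P(J,I))₁` is monotone. -/
theorem Ap_fst_mono {V : Type*} {A : Type*} [CompleteLattice V]
    (ng : V → V) (P : Set (Rule V A)) (hP : GoodProgram P) (I : A → V) :
    Monotone (fun J => (Ap ng P (J, I)).1) := by
  intro J K hJK p
  apply sSup_le
  rintro v ⟨r, hr, hp, rfl⟩
  exact ((hP r hr).2.1 _ (FForm.evalPair_mono ng I r.body (hP r hr).1 hJK)).trans
    (le_sSup ⟨r, hr, hp, rfl⟩)

/-- For a monotone operator, `lfp` is the least fixpoint. -/
theorem lfp_isLeast {α : Type*} [CompleteLattice α] (F : α → α) (hF : Monotone F) :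
    IsLeast {x | F x = x} (lfp F) :=
  OrderHom.isLeast_lfp ⟨F, hF⟩

/-- `lfp(J ↦ (A_P(J,I))₁) = lfp(T_{P_I})` (both operators are
`≤`-monotone, so these are genuine least fixpoints). -/
theorem lfp_Ap_fst_eq_lfp_Tp_reduct
    {V : Type*} {A : Type*} [CompleteLattice V]
    (ng : V → V) (hng_anti : Antitone ng) (hng_inv : Function.Involutive ng)
    (P : Set (Rule V A)) (hPfin : P.Finite) (hP : GoodProgram P)
    (I : A → V) :
    lfp (fun J => (Ap ng P (J, I)).1) = lfp (Tp ng (reductP ng P I)) := by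
  rw [Ap_fst_eq_Tp_reductP]
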